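/- arXiv:math/0509537 — 11 statements merged into one kernel-verified Lean document; each statement's English description precedes it below -/
import Mathlib

section
/- IV(0,1) = { k/(k+1) : k ∈ ℕ, k ≥ 1 }. That is, a real number Π ∈ (0,1) has the intermediate value property for binary sequences if and only if Π = k/(k+1) for some positive integer k. -/
/-- The average of the first `n` terms of a sequence `x` (terms `x 0, ..., x (n-1)`). -/
noncomputable def avgSeq (x : ℕ → ℝ) (n : ℕ) : ℝ := (∑ i ∈ Finset.range n, x i) / n

/-- `IV A a b` : the set of "intermediate values" `P ∈ (a,b)` such that for every sequence with
terms in `A`, the consecutive averages cannot pass from below `P` to above `P` without hitting `P`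
at an intermediate index. -/
def IV (A : Set ℝ) (a b : ℝ) : Set ℝ :=
  {P | P ∈ Set.Ioo a b ∧ ∀ x : ℕ → ℝ, (∀ n, x n ∈ A) →
    ∀ k l : ℕ, 1 ≤ k → k < l → avgSeq x k < P → P < avgSeq x l →
      ∃ s : ℕ, k < s ∧ s < l ∧ avgSeq x s = P}

/-- An integer sequence whose upward steps are at most one cannot jump over zero. -/
theorem exists_eq_zero_of_upward_steps_le_one {d : ℕ → ℤ} (hd : ∀ n, d (n + 1) ≤ d n + 1)
    {k l : ℕ} (hkl : k < l) (hk : d k < 0) (hl : 0 < d l) :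
    ∃ s, k < s ∧ s < l ∧ d s = 0 := by
  induction l, hkl using Nat.le_induction with
  | base =>
    have := hd k
    simp only [Nat.succ_eq_add_one] at hl
    omega
  | succ l hkl ih =>
    rcases lt_or_ge 0 (d l) with h | h
    · obtain ⟨s, hks, hsl, hs⟩ := ih h
      exact ⟨s, hks, by omega, hs⟩
    · have := hd l
      exact ⟨l, hkl, by omega, by omega⟩

/-- The averages of the sequence `0, 1, 1, 1, ...`. -/
theorem avgSeq_zero_then_ones (n : ℕ) :
    avgSeq (fun i => if i = 0 then 0 else 1) (n + 1) = (n : ℝ) / (n + 1) := by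
  simp [avgSeq, Finset.sum_range_succ']

/-- THEOREM 1: `IV(0,1) = { k/(k+1) : k ≥ 1 }`. -/
theorem IV_zero_one :
    IV ({0, 1} : Set ℝ) 0 1 = {y : ℝ | ∃ k : ℕ, 1 ≤ k ∧ y = (k : ℝ) / (k + 1)} := by
  ext P
  constructor
  · rintro ⟨⟨hP0, hP1⟩, h⟩
    obtain ⟨n, hn⟩ := exists_nat_gt (P / (1 - P))
    have hnP : P < (n : ℝ) / (n + 1) := by
      rw [div_lt_iff₀ (by linarith)] at hn
      rw [lt_div_iff₀ (by positivity)]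
      linarith
    have hn1 : 0 < n := by
      rcases Nat.eq_zero_or_pos n with rfl | hpos
      · simp at hnP
        linarith
      · exact hpos
    obtain ⟨s, hs1, -, hs⟩ := h (fun i => if i = 0 then 0 else 1)
      (fun i => by by_cases hi : i = 0 <;> simp [hi]) 1 (n + 1) le_rfl (by omega)
      (by simpa [avgSeq] using hP0) (by rwa [avgSeq_zero_then_ones])
    obtain ⟨j, rfl⟩ : ∃ j, s = j + 1 := ⟨s - 1, by omega⟩
    exact ⟨j, by omega, by rw [← hs, avgSeq_zero_then_ones]⟩
  · rintro ⟨m, hm, rfl⟩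
    have hm0 : (0 : ℝ) < m := by exact_mod_cast hm
    refine ⟨⟨by positivity, by rw [div_lt_one (by positivity)]; linarith⟩, ?_⟩
    intro x hx k l hk hkl hxk hxl
    have hb : ∀ i, ∃ b : ℤ, x i = b ∧ (b = 0 ∨ b = 1) := by
      intro i
      rcases hx i with h | h
      · exact ⟨0, by simpa using h, Or.inl rfl⟩
      · exact ⟨1, by simpa using h, Or.inr rfl⟩
    choose b hxb hb using hb
    let d : ℕ → ℤ := fun n => (m + 1) * ∑ i ∈ Finset.range n, b i - m * n
    have hd : ∀ n, d (n + 1) ≤ d n + 1 := by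
      intro n
      simp only [d, Finset.sum_range_succ]
      push_cast
      rcases hb n with h | h <;> rw [h] <;> linarith [Int.natCast_nonneg m]
    have key : ∀ n, 1 ≤ n → avgSeq x n - (m : ℝ) / (m + 1) = d n / (n * (m + 1)) := by
      intro n hn
      have hn0 : (n : ℝ) ≠ 0 := by exact_mod_cast (by omega : n ≠ 0)
      simp only [avgSeq, d, hxb]
      push_cast
      field_simp
    have hdk : d k < 0 := by
      have hk0 : (0 : ℝ) < k := by exact_mod_cast hk
      have h := sub_neg.mpr hxk
      rw [key k hk, div_lt_iff₀ (by positivity), zero_mul] at h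
      exact_mod_cast h
    have hdl : 0 < d l := by
      have hl0 : (0 : ℝ) < l := by exact_mod_cast (by omega : 0 < l)
      have h := sub_pos.mpr hxl
      rw [key l (by omega), lt_div_iff₀ (by positivity), zero_mul] at h
      exact_mod_cast h
    obtain ⟨s, hks, hsl, hs⟩ := exists_eq_zero_of_upward_steps_le_one hd hkl hdk hdl
    refine ⟨s, hks, hsl, sub_eq_zero.mp ?_⟩
    rw [key s (by omega), hs, Int.cast_zero, zero_div]
end

section
/- For every positive integer k, the number k/(k+1) belongs to IV(0,1): for every binary sequence {x_n} (with x_n ∈ {0,1} for all n ≥ 1), there is no index n ≥ 1 with x̄_n < k/(k+1) < x̄_{n+1}, and consequently whenever x̄_j < k/(k+1) < x̄_l with j < l, there exists s with j < s < l and x̄_s = k/(k+1). -/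
/-- The integer walk with step `1` where `x i = 1` and step `-k` elsewhere: its sign at time `n`
is the sign of `avgSeq x n - k / (k + 1)`. -/
noncomputable def fracWalk (k : ℕ) (x : ℕ → ℝ) (n : ℕ) : ℤ :=
  open Classical in ∑ i ∈ Finset.range n, if x i = 1 then 1 else -(k : ℤ)

theorem fracWalk_succ_le (k : ℕ) (x : ℕ → ℝ) (n : ℕ) :
    fracWalk k x (n + 1) ≤ fracWalk k x n + 1 := by
  rw [fracWalk, Finset.sum_range_succ, ← fracWalk]
  split_ifs <;> omega

theorem cast_fracWalk (k : ℕ) {x : ℕ → ℝ} (hx : ∀ n, x n = 0 ∨ x n = 1) (n : ℕ) :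
    (fracWalk k x n : ℝ) = (k + 1) * ∑ i ∈ Finset.range n, x i - k * n := by
  induction n with
  | zero => simp [fracWalk]
  | succ n ih =>
    rw [fracWalk, Finset.sum_range_succ, ← fracWalk, Finset.sum_range_succ]
    push_cast
    rw [ih]
    rcases hx n with h | h <;> simp [h] <;> ring

theorem avgSeq_sub_frac (k : ℕ) {x : ℕ → ℝ} (hx : ∀ n, x n = 0 ∨ x n = 1) {n : ℕ}
    (hn : 1 ≤ n) :
    avgSeq x n - (k : ℝ) / (k + 1) = fracWalk k x n / ((k + 1) * n) := by
  have hn' : (n : ℝ) ≠ 0 := by positivity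
  have hk' : (k : ℝ) + 1 ≠ 0 := by positivity
  rw [cast_fracWalk k hx, avgSeq]
  field_simp

theorem avgSeq_lt_frac_iff (k : ℕ) {x : ℕ → ℝ} (hx : ∀ n, x n = 0 ∨ x n = 1) {n : ℕ}
    (hn : 1 ≤ n) : avgSeq x n < (k : ℝ) / (k + 1) ↔ fracWalk k x n < 0 := by
  have hpos : (0 : ℝ) < (k + 1) * n := by positivity
  rw [← sub_neg, avgSeq_sub_frac k hx hn, div_lt_iff₀ hpos, zero_mul, Int.cast_lt_zero]

theorem frac_lt_avgSeq_iff (k : ℕ) {x : ℕ → ℝ} (hx : ∀ n, x n = 0 ∨ x n = 1) {n : ℕ}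
    (hn : 1 ≤ n) : (k : ℝ) / (k + 1) < avgSeq x n ↔ 0 < fracWalk k x n := by
  have hpos : (0 : ℝ) < (k + 1) * n := by positivity
  rw [← sub_pos, avgSeq_sub_frac k hx hn, lt_div_iff₀ hpos, zero_mul, Int.cast_pos]

/-- An integer sequence with upward steps at most `1` cannot skip `0` on its way up. -/
theorem exists_eq_zero_of_succ_le {f : ℕ → ℤ} (hf : ∀ n, f (n + 1) ≤ f n + 1) {j l : ℕ}
    (hjl : j < l) (hj : f j < 0) (hl : 0 < f l) : ∃ s, j < s ∧ s < l ∧ f s = 0 := by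
  induction l, hjl using Nat.le_induction with
  | base => exact absurd hl (by have := hf j; rw [Nat.succ_eq_add_one]; omega)
  | succ l hjl ih =>
    rcases eq_or_ne (f l) 0 with h | h
    · exact ⟨l, hjl, l.lt_succ_self, h⟩
    · obtain ⟨s, hjs, hsl, hs⟩ := ih (by have := hf l; omega)
      exact ⟨s, hjs, hsl.trans l.lt_succ_self, hs⟩

/-- For every positive integer `k`, the number `k/(k+1)` belongs to `IV(0,1)`: for every binary
sequence its averages never satisfy `x̄_n < k/(k+1) < x̄_{n+1}`, and consequently the averages
cannot pass from below `k/(k+1)` to above it without taking that value at an intermediate index. -/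
theorem frac_mem_IV_zero_one (k : ℕ) (hk : 1 ≤ k) (x : ℕ → ℝ)
    (hx : ∀ n, x n = 0 ∨ x n = 1) :
    (∀ n : ℕ, 1 ≤ n →
        ¬ (avgSeq x n < (k : ℝ) / (k + 1) ∧ (k : ℝ) / (k + 1) < avgSeq x (n + 1))) ∧
    (∀ j l : ℕ, 1 ≤ j → j < l →
        avgSeq x j < (k : ℝ) / (k + 1) → (k : ℝ) / (k + 1) < avgSeq x l →
        ∃ s : ℕ, j < s ∧ s < l ∧ avgSeq x s = (k : ℝ) / (k + 1)) := by
  constructor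
  · rintro n hn ⟨h₁, h₂⟩
    rw [avgSeq_lt_frac_iff k hx hn] at h₁
    rw [frac_lt_avgSeq_iff k hx (Nat.le_add_left 1 n)] at h₂
    have := fracWalk_succ_le k x n
    omega
  · intro j l hj hjl h₁ h₂
    rw [avgSeq_lt_frac_iff k hx hj] at h₁
    rw [frac_lt_avgSeq_iff k hx (hj.trans hjl.le)] at h₂
    obtain ⟨s, hjs, hsl, hs⟩ := exists_eq_zero_of_succ_le (fracWalk_succ_le k x) hjl h₁ h₂
    refine ⟨s, hjs, hsl, sub_eq_zero.mp ?_⟩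
    rw [avgSeq_sub_frac k hx (hj.trans hjs.le), hs, Int.cast_zero, zero_div]
end

section
/- For real numbers a < b, IV(a,b) = { a/(k+1) + k·b/(k+1) : k ∈ ℕ, k ≥ 1 }. -/
/-- An integer sequence whose increments are at most `1` cannot pass from negative to positive
values without vanishing in between. -/
theorem exists_eq_zero_of_increment_le_one (m : ℕ → ℤ) (hm : ∀ n, m (n + 1) ≤ m n + 1) {k l : ℕ}
    (hkl : k < l) (hk : m k < 0) (hl : 0 < m l) : ∃ s, k < s ∧ s < l ∧ m s = 0 := by
  have key : ∀ n, k ≤ n → m n < 0 ∨ ∃ s, k < s ∧ s ≤ n ∧ m s = 0 := by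
    intro n hn
    induction n, hn using Nat.le_induction with
    | base => exact Or.inl hk
    | succ n hn ih =>
      rcases ih with h | ⟨s, h1, h2, h3⟩
      · rcases lt_or_ge (m (n + 1)) 0 with h' | h'
        · exact Or.inl h'
        · exact Or.inr ⟨n + 1, by omega, le_rfl, by have := hm n; omega⟩
      · exact Or.inr ⟨s, h1, by omega, h3⟩
  rcases key l hkl.le with h | ⟨s, h1, h2, h3⟩
  · omega
  · refine ⟨s, h1, lt_of_le_of_ne h2 ?_, h3⟩
    rintro rfl
    omega

theorem avgSeq_sub (x : ℕ → ℝ) (P : ℝ) {n : ℕ} (hn : 1 ≤ n) :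
    avgSeq x n - P = (∑ i ∈ Finset.range n, (x i - P)) / n := by
  have h : (n : ℝ) ≠ 0 := by positivity
  rw [avgSeq, Finset.sum_sub_distrib, Finset.sum_const, Finset.card_range, nsmul_eq_mul]
  field_simp

theorem avgSeq_cons_const (a b : ℝ) (n : ℕ) :
    avgSeq (fun i => if i = 0 then a else b) (n + 1) = (a + n * b) / (n + 1) := by
  simp [avgSeq, Finset.sum_range_succ', add_comm]

/-- THEOREM 2: for `a < b`, `IV(a,b) = { a/(k+1) + k·b/(k+1) : k ≥ 1 }`. -/
theorem IV_pair (a b : ℝ) (hab : a < b) :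
    IV ({a, b} : Set ℝ) a b =
      {y : ℝ | ∃ k : ℕ, 1 ≤ k ∧ y = a / (k + 1) + (k : ℝ) * b / (k + 1)} := by
  ext P
  constructor
  · rintro ⟨⟨haP, hPb⟩, h⟩
    have hbP : 0 < b - P := sub_pos.2 hPb
    have ht : 0 < (P - a) / (b - P) := div_pos (sub_pos.2 haP) hbP
    set n := ⌊(P - a) / (b - P)⌋₊
    have hle : n * (b - P) ≤ P - a := (le_div_iff₀ hbP).1 (Nat.floor_le ht.le)
    have hlt : P - a < (n + 1) * (b - P) := (div_lt_iff₀ hbP).1 (Nat.lt_floor_add_one _)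
    have hn : (0 : ℝ) < n + 1 := by positivity
    have hn' : (0 : ℝ) < n + 1 + 1 := by positivity
    rcases hle.eq_or_lt with heq | hlt'
    · refine ⟨n, ?_, ?_⟩
      · rw [Nat.one_le_iff_ne_zero]
        intro h0
        rw [h0, Nat.cast_zero, zero_mul] at heq
        linarith
      · field_simp
        linarith
    · obtain ⟨s, h1, h2, -⟩ := h (fun i => if i = 0 then a else b)
        (fun i => by by_cases hi : i = 0 <;> simp [hi]) (n + 1) (n + 1 + 1)
        (by omega) (by omega)
        (by rw [avgSeq_cons_const, div_lt_iff₀ hn]; linarith)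
        (by rw [avgSeq_cons_const]; push_cast; rw [lt_div_iff₀ hn']; linarith)
      omega
  · rintro ⟨k, hk, rfl⟩
    have hk0 : (0 : ℝ) < k := by exact_mod_cast hk
    have hk1 : (0 : ℝ) < k + 1 := by positivity
    set P := a / (k + 1) + (k : ℝ) * b / (k + 1)
    set δ := (b - a) / (k + 1)
    have hδ : 0 < δ := div_pos (sub_pos.2 hab) hk1
    have hb : b - P = δ := by simp only [P, δ]; field_simp; ring
    have ha : a - P = -k * δ := by simp only [P, δ]; field_simp; ring
    have hkδ : 0 < k * δ := mul_pos hk0 hδ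
    refine ⟨⟨by linarith, by linarith⟩, fun x hx i l hi hil hlow hhigh => ?_⟩
    have hstep : ∀ n, ∃ e : ℤ, e ≤ 1 ∧ x n - P = e * δ := by
      intro n
      rcases hx n with h | h
      · exact ⟨-k, by omega, by rw [h, ha]; push_cast; ring⟩
      · exact ⟨1, le_rfl, by rw [Set.mem_singleton_iff.1 h, hb]; push_cast; ring⟩
    choose e he1 he using hstep
    have havg : ∀ n, 1 ≤ n →
        avgSeq x n - P = ((∑ j ∈ Finset.range n, e j : ℤ) : ℝ) * (δ / n) := by
      intro n hn
      rw [avgSeq_sub x P hn, Finset.sum_congr rfl fun j _ => he j, ← Finset.sum_mul, mul_div_assoc]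
      push_cast
      rfl
    have hpos : ∀ n : ℕ, 1 ≤ n → 0 < δ / n := fun n hn => div_pos hδ (by exact_mod_cast hn)
    obtain ⟨s, h1, h2, h3⟩ := exists_eq_zero_of_increment_le_one
      (fun n => ∑ j ∈ Finset.range n, e j)
      (fun n => by simp only [Finset.sum_range_succ]; linarith [he1 n]) hil
      (by
        have : ((∑ j ∈ Finset.range i, e j : ℤ) : ℝ) < 0 :=
          neg_of_mul_neg_left (havg i hi ▸ sub_neg.2 hlow) (hpos i hi).le
        exact_mod_cast this)
      (by
        have : (0 : ℝ) < (∑ j ∈ Finset.range l, e j : ℤ) :=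
          pos_of_mul_pos_left (havg l (by omega) ▸ sub_pos.2 hhigh) (hpos l (by omega)).le
        exact_mod_cast this)
    refine ⟨s, h1, h2, sub_eq_zero.1 ?_⟩
    rw [havg s (by omega), h3, Int.cast_zero, zero_mul]
end

section
/- If 0 < μ < 1 and μ is irrational, then IV(0,μ,1) = ∅. -/
/-- A sequence whose averages jump over `P` in the single step from `n` to `n + 1`, where the
term `1` is appended to an initial segment of sum `n - D`, shows `P ∉ IV A a b`. -/
theorem notMem_IV_of_sum_eq {A : Set ℝ} {a b P D : ℝ} {x : ℕ → ℝ} {n : ℕ} (hx : ∀ i, x i ∈ A)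
    (hn : 1 ≤ n) (hsum : ∑ i ∈ Finset.range n, x i = n - D) (hxn : x n = 1)
    (hlo : n * (1 - P) < D) (hhi : D < (n + 1) * (1 - P)) : P ∉ IV A a b := by
  rintro ⟨-, h⟩
  have hn0 : (0 : ℝ) < n := by exact_mod_cast hn
  obtain ⟨s, hs, hs', -⟩ := h x hx n (n + 1) hn n.lt_succ_self
    (by rw [avgSeq, hsum, div_lt_iff₀ hn0]; linarith)
    (by
      rw [avgSeq, Finset.sum_range_succ, hsum, hxn, Nat.cast_succ, lt_div_iff₀ (by positivity)]
      linarith)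
  omega

/-- THEOREM 3: if `0 < μ < 1` is irrational, then `IV(0, μ, 1) = ∅`. -/
theorem IV_ternary_irrational (μ : ℝ) (h0 : 0 < μ) (h1 : μ < 1) (hirr : Irrational μ) :
    IV ({0, μ, 1} : Set ℝ) 0 1 = ∅ := by
  refine Set.eq_empty_of_forall_notMem fun P hP => ?_
  obtain ⟨hP0, hP1⟩ := hP.1
  have hq : 0 < 1 - P := by linarith
  have ht : 1 < 1 / (1 - P) := by rw [lt_div_iff₀ hq]; linarith
  rcases (Nat.floor_le (zero_le_one.trans ht.le)).lt_or_eq with hlt | heq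
  · have hfl := Nat.lt_floor_add_one (1 / (1 - P))
    have hn : 1 ≤ ⌊1 / (1 - P)⌋₊ := Nat.le_floor (by exact_mod_cast ht.le)
    generalize ⌊1 / (1 - P)⌋₊ = n at *
    obtain ⟨k, rfl⟩ := Nat.exists_eq_add_of_le' hn
    rw [lt_div_iff₀ hq] at hlt
    rw [div_lt_iff₀ hq] at hfl
    refine notMem_IV_of_sum_eq (x := fun i => if i = 0 then 0 else 1) (n := k + 1) (D := 1)
      (fun i => ?_) hn ?_ (by simp) hlt hfl hP
    · split_ifs <;> simp
    · simp [Finset.sum_range_succ']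
  · generalize ⌊1 / (1 - P)⌋₊ = m at heq
    rw [← heq] at ht
    rw [eq_div_iff hq.ne'] at heq
    have hm : (2 : ℝ) ≤ m := by exact_mod_cast ht
    have hm0 : m ≠ 0 := by rintro rfl; norm_num at hm
    have hD : Irrational (m * (2 - μ)) := by
      simpa using (hirr.natCast_sub 2).natCast_mul hm0
    have hpos : 2 ≤ m * (2 - μ) := by nlinarith
    have hn : 2 ≤ ⌊m * (2 - μ)⌋₊ := Nat.le_floor (by exact_mod_cast hpos)
    have hlt := (Nat.floor_le (zero_le_two.trans hpos)).lt_of_ne (hD.ne_nat _).symm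
    have hfl := Nat.lt_floor_add_one (m * (2 - μ))
    generalize ⌊m * (2 - μ)⌋₊ = n at *
    obtain ⟨k, rfl⟩ := Nat.exists_eq_add_of_le' hn
    have key : m * (2 - μ) * (1 - P) = 2 - μ := by linear_combination (2 - μ) * heq
    refine notMem_IV_of_sum_eq (n := k + 2) (D := 2 - μ)
      (x := fun i => if i = 0 then 0 else if i = 1 then μ else 1)
      (fun i => ?_) (by omega) ?_ (by simp) ?_ ?_ hP
    · split_ifs <;> simp
    · simp [Finset.sum_range_succ']
      ring
    · rw [← key]
      exact mul_lt_mul_of_pos_right hlt hq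
    · rw [← key]
      exact mul_lt_mul_of_pos_right hfl hq
end

section
/- Let 0 < μ < 1 be irrational and let Π = k/(k+1) for some positive integer k. Then Π is skipped by the consecutive averages of some sequence with all terms in {0, μ, 1}: if Π < μ the averages of the sequence 0, μ, μ, μ, ... skip Π, and if Π > μ the averages of the sequence μ, 1, 1, 1, ... skip Π. -/
/-- The average of the first `m + 1` terms of the sequence `c, d, d, d, ...`. -/
lemma avgSeq_ite_succ (c d : ℝ) (m : ℕ) :
    avgSeq (fun i => if i = 0 then c else d) (m + 1) = (c + m * d) / (m + 1) := by
  simp [avgSeq, Finset.sum_range_succ', add_comm]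

/-- A real sequence that starts below `P`, avoids `P` and is somewhere above `P` jumps over `P`
in a single step. -/
lemma exists_lt_and_lt_succ {α : Type*} [LinearOrder α] {a : ℕ → α} {P : α} (h0 : a 0 < P)
    (hne : ∀ m, a m ≠ P) (hex : ∃ m, P < a m) : ∃ m, a m < P ∧ P < a (m + 1) := by
  by_contra! h
  obtain ⟨m, hm⟩ := hex
  have hlt : ∀ m, a m < P := fun m => by
    induction m with
    | zero => exact h0
    | succ m ih => exact lt_of_le_of_ne (h m ih) (hne _)
  exact lt_asymm hm (hlt m)

/-- If `c < P < d` and no average of `c, d, d, d, ...` equals `P`, then these averages skip `P`. -/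
lemma exists_avgSeq_ite_skip {c d P : ℝ} (hc : c < P) (hd : P < d)
    (hne : ∀ m : ℕ, c + m * d ≠ P * (m + 1)) :
    ∃ n : ℕ, 1 ≤ n ∧ avgSeq (fun i => if i = 0 then c else d) n < P ∧
      P < avgSeq (fun i => if i = 0 then c else d) (n + 1) := by
  have hpos (m : ℕ) : (0 : ℝ) < m + 1 := by positivity
  obtain ⟨m, hm⟩ := exists_lt_and_lt_succ (P := P)
    (a := fun m => avgSeq (fun i => if i = 0 then c else d) (m + 1))
    (by simpa [avgSeq] using hc)
    (fun m => by
      simp only [avgSeq_ite_succ, ne_eq, div_eq_iff (hpos m).ne']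
      exact hne m)
    (by
      obtain ⟨m, hm⟩ := exists_nat_gt ((P - c) / (d - P))
      refine ⟨m, ?_⟩
      rw [div_lt_iff₀ (sub_pos.2 hd)] at hm
      simp only [avgSeq_ite_succ, lt_div_iff₀ (hpos m)]
      linarith)
  exact ⟨m + 1, by omega, hm⟩

/-- Let `0 < μ < 1` be irrational and `P = k/(k+1)` with `k ≥ 1`. If `P < μ` then the averages
of `0, μ, μ, μ, ...` skip `P`, and if `P > μ` then the averages of `μ, 1, 1, 1, ...` skip `P`. -/
theorem irrational_skips_fracs (μ : ℝ) (h0 : 0 < μ) (h1 : μ < 1) (hirr : Irrational μ)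
    (k : ℕ) (hk : 1 ≤ k) :
    ((k : ℝ) / (k + 1) < μ →
      ∃ n : ℕ, 1 ≤ n ∧
        avgSeq (fun i => if i = 0 then 0 else μ) n < (k : ℝ) / (k + 1) ∧
        (k : ℝ) / (k + 1) < avgSeq (fun i => if i = 0 then 0 else μ) (n + 1)) ∧
    (μ < (k : ℝ) / (k + 1) →
      ∃ n : ℕ, 1 ≤ n ∧
        avgSeq (fun i => if i = 0 then μ else 1) n < (k : ℝ) / (k + 1) ∧
        (k : ℝ) / (k + 1) < avgSeq (fun i => if i = 0 then μ else 1) (n + 1)) := by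
  have hP : (0 : ℝ) < k / (k + 1) := by positivity
  have hP1 : (k : ℝ) / (k + 1) < 1 := by
    rw [div_lt_one (by positivity)]
    linarith
  refine ⟨fun h => exists_avgSeq_ite_skip hP h fun m hm => ?_,
    fun h => exists_avgSeq_ite_skip h hP1 fun m hm => ?_⟩
  · rcases Nat.eq_zero_or_pos m with rfl | hm0
    · simp only [Nat.cast_zero] at hm
      linarith
    · have hm0' : (m : ℝ) ≠ 0 := by positivity
      refine hirr ⟨(k : ℚ) / (k + 1) * (m + 1) / m, ?_⟩
      push_cast
      rw [div_eq_iff hm0']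
      linarith
  · refine hirr ⟨(k : ℚ) / (k + 1) * (m + 1) - m, ?_⟩
    push_cast
    linarith
end

section
/- If p and q are relatively prime positive integers with 0 < p/q < 1, then IV(0, p/q, 1) = { 1 - 1/(q·t) : t ∈ ℕ, t ≥ 1 }. -/
/-- If all late partial sums of `x` equal `n - d`, then `d / (1 - P)` is a natural number for every
`P ∈ IV A a b` with `P < 1`. -/
lemma exists_nat_mul_eq_of_mem_IV {A : Set ℝ} {a b P d : ℝ} (hP : P ∈ IV A a b) (hP1 : P < 1)
    {x : ℕ → ℝ} (hx : ∀ n, x n ∈ A) {m : ℕ} (hm : 1 ≤ m)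
    (hsum : ∀ n, m ≤ n → ∑ i ∈ Finset.range n, x i = n - d) (hd : m * (1 - P) ≤ d) :
    ∃ N : ℕ, N * (1 - P) = d := by
  have hε : 0 < 1 - P := sub_pos.2 hP1
  have hmd : (m : ℝ) ≤ d / (1 - P) := (le_div_iff₀ hε).2 hd
  set n := ⌊d / (1 - P)⌋₊
  have hmn : m ≤ n := Nat.le_floor hmd
  have hle : (n : ℝ) * (1 - P) ≤ d :=
    (le_div_iff₀ hε).1 (Nat.floor_le ((Nat.cast_nonneg m).trans hmd))
  have hlt : d < ((n : ℝ) + 1) * (1 - P) := (div_lt_iff₀ hε).1 (Nat.lt_floor_add_one _)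
  have hn : (0 : ℝ) < n := by exact_mod_cast hm.trans hmn
  refine ⟨n, hle.antisymm (not_lt.1 fun h => ?_)⟩
  obtain ⟨s, hks, hsl, -⟩ := hP.2 x hx n (n + 1) (hm.trans hmn) n.lt_succ_self
    (by rw [avgSeq, hsum n hmn, div_lt_iff₀ hn]; linarith)
    (by
      rw [avgSeq, hsum (n + 1) (by omega), lt_div_iff₀ (by positivity)]
      push_cast
      linarith)
  omega

/-- If the deficits `n * P - ∑ i < n, x i` are multiples of `1 - P` and no term of `x` exceeds `1`,
then the averages of `x` cannot jump over `P` from below. -/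
lemma exists_avgSeq_eq {x : ℕ → ℝ} {P : ℝ} (hP1 : P < 1) (hx : ∀ n, x n ≤ 1)
    (hmul : ∀ n : ℕ, ∃ z : ℤ, n * P - ∑ i ∈ Finset.range n, x i = z * (1 - P))
    {k l : ℕ} (hk : 1 ≤ k) (hkl : k < l) (hxk : avgSeq x k < P) (hxl : P < avgSeq x l) :
    ∃ s : ℕ, k < s ∧ s < l ∧ avgSeq x s = P := by
  by_contra! hne
  have hbelow : ∀ n, k ≤ n → n ≤ l → 0 < n * P - ∑ i ∈ Finset.range n, x i := by
    intro n hkn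
    induction n, hkn using Nat.le_induction with
    | base =>
      intro _
      rw [avgSeq, div_lt_iff₀ (by exact_mod_cast hk)] at hxk
      linarith
    | succ n hkn ih =>
      intro hnl
      have hpos := ih (by omega)
      obtain ⟨z, hz⟩ := hmul n
      have hz1 : (1 : ℝ) ≤ z := by
        rw [hz] at hpos
        have : (0 : ℝ) < z := pos_of_mul_pos_left hpos (by linarith)
        exact_mod_cast this
      have hstep : 0 ≤ ((n + 1 : ℕ) : ℝ) * P - ∑ i ∈ Finset.range (n + 1), x i := by
        rw [Finset.sum_range_succ]
        push_cast
        nlinarith [hx n]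
      refine hstep.lt_of_ne fun h0 => ?_
      have havg : avgSeq x (n + 1) = P := by
        rw [avgSeq, div_eq_iff (by positivity)]
        linarith
      rcases hnl.lt_or_eq with h | h
      · exact hne (n + 1) (by omega) h havg
      · rw [← h, havg] at hxl
        exact hxl.false
  have h := hbelow l hkl.le le_rfl
  rw [avgSeq, lt_div_iff₀ (by exact_mod_cast hk.trans hkl.le)] at hxl
  linarith

/-- THEOREM 4: if `p, q` are relatively prime positive integers with `0 < p/q < 1`, then
`IV(0, p/q, 1) = { 1 - 1/(q·t) : t ≥ 1 }`. -/
theorem IV_ternary_rational (p q : ℕ) (hp : 0 < p) (hpq : p < q) (hcop : Nat.Coprime p q) :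
    IV ({0, (p : ℝ) / q, 1} : Set ℝ) 0 1 =
      {y : ℝ | ∃ t : ℕ, 1 ≤ t ∧ y = 1 - 1 / ((q : ℝ) * t)} := by
  have hq : (0 : ℝ) < q := by exact_mod_cast hp.trans hpq
  have hpq' : (p : ℝ) / q < 1 := (div_lt_one hq).2 (by exact_mod_cast hpq)
  ext P
  constructor
  · intro hP
    obtain ⟨hP0, hP1⟩ := hP.1
    obtain ⟨N, hN⟩ := exists_nat_mul_eq_of_mem_IV (d := 1) hP hP1
      (x := fun n => if n = 0 then 0 else 1) (fun n => by split_ifs <;> simp) le_rfl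
      (fun n hn => by
        obtain ⟨m, rfl⟩ := Nat.exists_eq_add_of_le' hn
        simp [Finset.sum_range_succ'])
      (by push_cast; linarith)
    have hN2 : 2 ≤ N := by
      by_contra! h
      have : (N : ℝ) ≤ 1 := by exact_mod_cast Nat.le_of_lt_succ h
      nlinarith
    have hN2' : (2 : ℝ) ≤ N := by exact_mod_cast hN2
    obtain ⟨M, hM⟩ := exists_nat_mul_eq_of_mem_IV (d := 2 - (p : ℝ) / q) (m := 2) hP hP1
      (x := fun n => if n = 0 then 0 else if n = 1 then (p : ℝ) / q else 1)
      (fun n => by split_ifs <;> simp) one_le_two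
      (fun n hn => by
        obtain ⟨m, rfl⟩ := Nat.exists_eq_add_of_le' hn
        simp [Finset.sum_range_succ']
        ring)
      (by push_cast; nlinarith)
    have hMN : (M : ℝ) = N * (2 - (p : ℝ) / q) := by
      rw [← hM]
      linear_combination (-(M : ℝ)) * hN
    have hNp : M * q + N * p = 2 * N * q := by
      have : (M : ℝ) * q + N * p = 2 * N * q := by
        rw [hMN]
        field_simp
        ring
      exact_mod_cast this
    have hdvd : q ∣ N := by
      refine hcop.symm.dvd_of_dvd_mul_right ?_
      exact (Nat.dvd_add_right (Dvd.intro_left M rfl)).1 (hNp ▸ Dvd.intro_left (2 * N) rfl)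
    obtain ⟨t, rfl⟩ := hdvd
    refine ⟨t, Nat.pos_of_ne_zero (by rintro rfl; simp at hN2), ?_⟩
    push_cast at hN hN2'
    have : 1 / ((q : ℝ) * t) = 1 - P := by
      rw [div_eq_iff (by linarith)]
      linarith
    linarith
  · rintro ⟨t, ht, rfl⟩
    have ht' : (1 : ℝ) ≤ t := by exact_mod_cast ht
    have hq1 : (1 : ℝ) < q := by exact_mod_cast (show 1 < q by omega)
    have hqt : (1 : ℝ) < q * t := by nlinarith
    have hε : 0 < 1 / ((q : ℝ) * t) := by positivity
    refine ⟨⟨sub_pos.2 ((div_lt_one (by linarith)).2 hqt), by linarith⟩, ?_⟩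
    intro x hx k l hk hkl hxk hxl
    refine exists_avgSeq_eq (by linarith) (fun n => ?_) (fun n => ?_) hk hkl hxk hxl
    · rcases hx n with h | h | h <;> rw [h] <;> linarith
    · have hsum : ∃ z : ℤ, ∑ i ∈ Finset.range n, x i = z / q := by
        induction n with
        | zero => exact ⟨0, by simp⟩
        | succ n ih =>
          obtain ⟨z, hz⟩ := ih
          rw [Finset.sum_range_succ, hz]
          rcases hx n with h | h | h <;> rw [h]
          · exact ⟨z, by simp⟩
          · exact ⟨z + p, by push_cast; ring⟩
          · exact ⟨z + q, by push_cast; field_simp⟩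
      obtain ⟨z, hz⟩ := hsum
      refine ⟨n * (q * t - 1) - t * z, ?_⟩
      rw [hz]
      push_cast
      field_simp
      ring
end

section
/- Let p and q be relatively prime positive integers with 0 < p/q < 1. If Π = k/(k+1) for a positive integer k and Π < p/q, then Π ∉ IV(0, p/q, 1); that is, Π is skipped by the consecutive averages of some sequence with all terms in {0, p/q, 1}. -/
/-- The first `n + 2` terms of the sequence `0, a, 1, 1, 1, ...` sum to `a + n`. -/
lemma sum_range_zero_then_const_then_ones (a : ℝ) (n : ℕ) :
    ∑ i ∈ Finset.range (n + 2), (if i = 0 then 0 else if i = 1 then a else 1 : ℝ) = a + n := by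
  induction n with
  | zero => simp [Finset.sum_range_succ]
  | succ n ih =>
    rw [show n + 1 + 2 = n + 2 + 1 by ring, Finset.sum_range_succ, ih]
    simp
    ring

/-- If `p, q` are coprime positive integers with `p < q` and `P = k/(k+1) < p/q` for a positive
integer `k`, then `P ∉ IV(0, p/q, 1)`. -/
theorem frac_below_not_mem_IV (p q : ℕ) (hp : 0 < p) (hpq : p < q) (hcop : Nat.Coprime p q)
    (k : ℕ) (hk : 1 ≤ k) (hlt : (k : ℝ) / (k + 1) < (p : ℝ) / q) :
    (k : ℝ) / (k + 1) ∉ IV ({0, (p : ℝ) / q, 1} : Set ℝ) 0 1 := by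
  rintro ⟨-, h⟩
  have hq : (0 : ℝ) < q := by exact_mod_cast hp.trans hpq
  have ha : (p : ℝ) / q < 1 := by
    rw [div_lt_one hq]
    exact_mod_cast hpq
  generalize (p : ℝ) / q = a at h hlt ha
  obtain ⟨j, rfl⟩ := Nat.exists_eq_add_of_le' hk
  have hj : (0 : ℝ) ≤ j := j.cast_nonneg
  obtain ⟨s, hs, hs', -⟩ := h (fun i => if i = 0 then 0 else if i = 1 then a else 1)
    (fun n => by split_ifs <;> simp) (j + 2) (j + 3) (by omega) (by omega)
    (by
      rw [avgSeq, sum_range_zero_then_const_then_ones]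
      push_cast
      rw [div_lt_div_iff₀ (by positivity) (by positivity)]
      nlinarith)
    (by
      rw [avgSeq, show j + 3 = j + 1 + 2 by ring, sum_range_zero_then_const_then_ones]
      push_cast at hlt ⊢
      rw [div_lt_iff₀ (by positivity)] at hlt
      rw [div_lt_div_iff₀ (by positivity) (by positivity)]
      nlinarith)
  omega
end

section
/- For every positive integer t and relatively prime positive integers p < q, the number 1 - 1/(q·t) belongs to IV(0, p/q, 1): for every sequence {x_n} with all terms in {0, p/q, 1}, the consecutive averages cannot increase from a value below 1 - 1/(q·t) to a value above it without taking the value 1 - 1/(q·t) at some intermediate index. -/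
/-- An integer sequence that decreases by at most one at each step takes the value `0` strictly
between an index where it is positive and a later index where it is negative. -/
theorem exists_eq_zero_of_sub_one_le {F : ℕ → ℤ} (hF : ∀ n, F n - 1 ≤ F (n + 1)) {k l : ℕ}
    (hkl : k < l) (hk : 0 < F k) (hl : F l < 0) : ∃ s, k < s ∧ s < l ∧ F s = 0 := by
  by_contra! h
  have key : ∀ n, k ≤ n → n < l → 0 < F n := by
    intro n hn
    induction n, hn using Nat.le_induction with
    | base => exact fun _ => hk
    | succ n hn ih =>
      intro hnl
      have h₁ := ih (by omega)
      have h₂ := h (n + 1) (by omega) hnl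
      have h₃ := hF n
      omega
  obtain ⟨m, rfl⟩ : ∃ m, l = m + 1 := ⟨l - 1, by omega⟩
  have h₁ := key m (by omega) (by omega)
  have h₂ := hF m
  omega

/-- The gap between `1 - 1 / (q t)` and an average of terms `1 - d i / q`. -/
theorem sub_avgSeq_eq {q t : ℝ} (hq : q ≠ 0) (ht : t ≠ 0) {x : ℕ → ℝ} {d : ℕ → ℤ}
    (hx : ∀ n, x n = 1 - d n / q) {n : ℕ} (hn : 1 ≤ n) :
    1 - 1 / (q * t) - avgSeq x n =
      (t * (∑ i ∈ Finset.range n, d i : ℤ) - n) / (q * t * n) := by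
  have hn' : (n : ℝ) ≠ 0 := by positivity
  simp only [avgSeq, hx, Finset.sum_sub_distrib, ← Finset.sum_div]
  push_cast
  simp only [Finset.sum_const, Finset.card_range, nsmul_eq_mul, mul_one]
  field_simp
  ring

/-- For every positive integer `t` and coprime positive integers `p < q`, the number
`1 - 1/(q·t)` belongs to `IV(0, p/q, 1)`. -/
theorem frac_mem_IV_ternary (p q : ℕ) (hp : 0 < p) (hpq : p < q) (hcop : Nat.Coprime p q)
    (t : ℕ) (ht : 1 ≤ t) :
    (1 - 1 / ((q : ℝ) * t)) ∈ IV ({0, (p : ℝ) / q, 1} : Set ℝ) 0 1 := by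
  have hq : (2 : ℝ) ≤ q := by exact_mod_cast (by omega : 2 ≤ q)
  have ht' : (1 : ℝ) ≤ t := by exact_mod_cast ht
  have hqt : 1 < (q : ℝ) * t := by nlinarith
  refine ⟨⟨?_, ?_⟩, ?_⟩
  · rw [sub_pos, div_lt_one (by linarith)]
    exact hqt
  · have : 0 < 1 / ((q : ℝ) * t) := by positivity
    linarith
  intro x hx k l hk hkl hlt hgt
  have hd : ∀ n, ∃ d : ℤ, 0 ≤ d ∧ x n = 1 - d / (q : ℝ) := by
    intro n
    rcases hx n with h | h | h
    · exact ⟨q, by omega, by rw [h]; push_cast; field_simp; simp⟩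
    · exact ⟨q - p, by omega, by rw [h]; push_cast; field_simp; ring⟩
    · exact ⟨0, le_rfl, by rw [h]; simp⟩
  choose d hd₀ hd using hd
  set F : ℕ → ℤ := fun n => t * (∑ i ∈ Finset.range n, d i) - n with hF
  have gap : ∀ n, 1 ≤ n → 1 - 1 / ((q : ℝ) * t) - avgSeq x n = (F n : ℝ) / (q * t * n) := by
    intro n hn
    rw [sub_avgSeq_eq (by positivity) (by positivity) hd hn]
    simp [hF]
  have den : ∀ n : ℕ, 1 ≤ n → 0 < (q : ℝ) * t * n := fun n hn => by positivity
  have step : ∀ n, F n - 1 ≤ F (n + 1) := by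
    intro n
    have : 0 ≤ (t : ℤ) * d n := mul_nonneg (by positivity) (hd₀ n)
    simp only [hF, Finset.sum_range_succ, mul_add]
    push_cast
    linarith
  have hFk : 0 < F k := by
    have h := sub_pos.2 hlt
    rw [gap k hk, div_pos_iff_of_pos_right (den k hk)] at h
    exact_mod_cast h
  have hFl : F l < 0 := by
    have h := sub_neg.2 hgt
    rw [gap l (by omega), div_lt_iff₀ (den l (by omega)), zero_mul] at h
    exact_mod_cast h
  obtain ⟨s, hks, hsl, hs⟩ := exists_eq_zero_of_sub_one_le step hkl hFk hFl
  refine ⟨s, hks, hsl, ?_⟩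
  have h := gap s (by omega)
  rw [hs, Int.cast_zero, zero_div] at h
  linarith
end

section
/- Let a < b < c be real numbers and set μ = (b - a)/(c - a). If μ is irrational, then IV(a,b,c) = ∅. If μ = p/q with p, q relatively prime positive integers, then IV(a,b,c) = { (1 - 1/(q·t))·c + (1/(q·t))·a : t ∈ ℕ, t ≥ 1 }. -/
/-- A sequence of integers with upward steps of size at most one cannot jump over zero. -/
theorem exists_eq_zero_of_step_le_one (D : ℕ → ℤ) (hD : ∀ n, D (n + 1) ≤ D n + 1) {k l : ℕ}
    (hkl : k < l) (hk : D k < 0) (hl : 0 < D l) : ∃ s, k < s ∧ s < l ∧ D s = 0 := by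
  classical
  have hex : ∃ m, 0 ≤ D (k + m) := ⟨l - k, by rw [Nat.add_sub_cancel' hkl.le]; exact hl.le⟩
  obtain ⟨m, hm, hmin⟩ : ∃ m, 0 ≤ D (k + m) ∧ ∀ j < m, D (k + j) < 0 :=
    ⟨Nat.find hex, Nat.find_spec hex, fun j hj => not_le.mp (Nat.find_min hex hj)⟩
  cases m with
  | zero => exact absurd hm (not_le.mpr hk)
  | succ m =>
    have h1 := hmin m (Nat.lt_succ_self m)
    have h2 := hD (k + m)
    have h0 : D (k + (m + 1)) = 0 := by
      rw [← add_assoc] at hm ⊢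
      omega
    refine ⟨k + (m + 1), by omega, ?_, h0⟩
    by_contra! hcon
    rcases hcon.eq_or_lt with h | h
    · rw [h, h0] at hl
      exact lt_irrefl _ hl
    · have h3 := hmin (l - k) (by omega)
      rw [Nat.add_sub_cancel' hkl.le] at h3
      omega

/-- If every increment `x - P` over `A` is an integer multiple, with factor at most one, of a fixed
positive number, then averages cannot jump upwards over `P`. -/
theorem mem_IV_of_forall_int_step {A : Set ℝ} {a b P N δ : ℝ} (hP : P ∈ Set.Ioo a b) (hN : 0 < N)
    (hδ : 0 < δ) (hA : ∀ y ∈ A, ∃ d : ℤ, d ≤ 1 ∧ N * (y - P) = d * δ) : P ∈ IV A a b := by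
  refine ⟨hP, fun x hx k l hk hkl hkP hlP => ?_⟩
  choose d hd1 hd using fun n => hA (x n) (hx n)
  let D : ℕ → ℤ := fun n => ∑ i ∈ Finset.range n, d i
  have key : ∀ n, 1 ≤ n → N * n * (avgSeq x n - P) = D n * δ := by
    intro n hn
    have hn' : (n : ℝ) ≠ 0 := by positivity
    have h : (D n : ℝ) * δ = N * (∑ i ∈ Finset.range n, x i - n * P) := by
      simp only [D, Int.cast_sum, Finset.sum_mul, ← hd, ← Finset.mul_sum, Finset.sum_sub_distrib,
        Finset.sum_const, Finset.card_range, nsmul_eq_mul]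
    rw [h, avgSeq]
    field_simp
  have hpos : ∀ n : ℕ, 1 ≤ n → 0 < N * (n : ℝ) := fun n hn => by positivity
  have hDk : D k < 0 := by
    have h := mul_neg_of_pos_of_neg (hpos k hk) (sub_neg.mpr hkP)
    rw [key k hk] at h
    exact_mod_cast (neg_iff_pos_of_mul_neg h).mpr hδ
  have hDl : 0 < D l := by
    have h := mul_pos (hpos l (hk.trans hkl.le)) (sub_pos.mpr hlP)
    rw [key l (hk.trans hkl.le)] at h
    exact_mod_cast (pos_iff_pos_of_mul_pos h).mpr hδ
  obtain ⟨s, hks, hsl, hs⟩ := exists_eq_zero_of_step_le_one D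
    (fun n => by simp only [D, Finset.sum_range_succ]; linarith [hd1 n]) hkl hDk hDl
  refine ⟨s, hks, hsl, ?_⟩
  have h := key s (hk.trans hks.le)
  rw [hs, Int.cast_zero, zero_mul] at h
  exact sub_eq_zero.mp ((mul_eq_zero.mp h).resolve_left (hpos s (hk.trans hks.le)).ne')

/-- The averages of the sequence `a, y, c, c, c, …` have to hit every value in `IV A a c`. -/
theorem exists_hit_of_mem_IV {A : Set ℝ} {a c P y : ℝ} (ha : a ∈ A) (hc : c ∈ A) (hy : y ∈ A)
    (hP : P ∈ IV A a c) : ∃ s : ℕ, 1 < s ∧ a + y + ((s : ℝ) - 2) * c = P * s := by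
  obtain ⟨⟨haP, hPc⟩, hIV⟩ := hP
  let x : ℕ → ℝ := fun n => if n = 0 then a else if n = 1 then y else c
  have hx : ∀ n, x n ∈ A := fun n => by
    unfold x
    split_ifs <;> assumption
  have hsum : ∀ n, ∑ i ∈ Finset.range (n + 2), x i = a + y + n * c := by
    intro n
    induction n with
    | zero => simp [x, Finset.sum_range_succ]
    | succ n ih =>
      have hxn : x (n + 2) = c := by simp [x]
      rw [show n + 1 + 2 = n + 2 + 1 by ring, Finset.sum_range_succ, ih, hxn]
      push_cast
      ring
  obtain ⟨n, hn⟩ := exists_nat_gt ((2 * P - a - y) / (c - P))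
  rw [div_lt_iff₀ (sub_pos.mpr hPc)] at hn
  obtain ⟨s, h1s, -, hs⟩ := hIV x hx 1 (n + 2) le_rfl (by omega)
    (by simpa [avgSeq, x] using haP)
    (by
      rw [avgSeq, hsum, lt_div_iff₀ (by positivity)]
      push_cast
      linarith)
  refine ⟨s, h1s, ?_⟩
  obtain ⟨m, rfl⟩ := Nat.exists_eq_add_of_le' h1s
  rw [avgSeq, hsum, div_eq_iff (by positivity)] at hs
  rw [← hs]
  push_cast
  ring

/-- Values in `IV {a, b, c} a c` have the form `c - (c - a) / s` where `s * (b - a) / (c - a)` is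
an integer. -/
theorem exists_of_mem_IV_three {a b c P : ℝ} (hac : a < c) (hP : P ∈ IV {a, b, c} a c) :
    ∃ (s : ℕ) (z : ℤ), 0 < s ∧ P = (1 - 1 / (s : ℝ)) * c + 1 / (s : ℝ) * a ∧
      (b - a) / (c - a) = (z : ℝ) / s := by
  obtain ⟨s, h1s, hs⟩ := exists_hit_of_mem_IV (y := c) (by simp) (by simp) (by simp) hP
  obtain ⟨m, -, hm⟩ := exists_hit_of_mem_IV (y := b) (by simp) (by simp) (by simp) hP
  have hs0 : (s : ℝ) ≠ 0 := by positivity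
  have hPs : P = (1 - 1 / (s : ℝ)) * c + 1 / (s : ℝ) * a := by
    field_simp
    linarith
  refine ⟨s, 2 * s - m, by omega, hPs, ?_⟩
  rw [div_eq_div_iff (sub_pos.mpr hac).ne' hs0]
  push_cast
  linear_combination (s : ℝ) * hm - (m : ℝ) * hs

/-- THEOREM 5: let `a < b < c` and `μ = (b - a)/(c - a)`. If `μ` is irrational then
`IV(a,b,c) = ∅`; if `μ = p/q` with `p, q` coprime positive integers then
`IV(a,b,c) = { (1 - 1/(q·t))·c + (1/(q·t))·a : t ≥ 1 }`. -/
theorem IV_three (a b c : ℝ) (hab : a < b) (hbc : b < c) :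
    (Irrational ((b - a) / (c - a)) → IV ({a, b, c} : Set ℝ) a c = ∅) ∧
    (∀ p q : ℕ, 0 < p → 0 < q → Nat.Coprime p q → (b - a) / (c - a) = (p : ℝ) / q →
      IV ({a, b, c} : Set ℝ) a c =
        {y : ℝ | ∃ t : ℕ, 1 ≤ t ∧
          y = (1 - 1 / ((q : ℝ) * t)) * c + (1 / ((q : ℝ) * t)) * a}) := by
  have hac := hab.trans hbc
  have hδ : 0 < c - a := sub_pos.mpr hac
  refine ⟨fun hirr => Set.eq_empty_iff_forall_notMem.mpr fun P hP => ?_, ?_⟩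
  · obtain ⟨s, z, -, -, hz⟩ := exists_of_mem_IV_three hac hP
    exact hirr ⟨(z : ℚ) / s, by rw [hz]; push_cast; rfl⟩
  intro p q hp hq hpq hμ
  ext P
  constructor
  · intro hP
    obtain ⟨s, z, hs, hPs, hz⟩ := exists_of_mem_IV_three hac hP
    rw [hμ, div_eq_div_iff (by positivity) (by positivity)] at hz
    have hdvd : (q : ℤ) ∣ p * s := ⟨z, by rw [mul_comm (q : ℤ)]; exact_mod_cast hz⟩
    obtain ⟨t, rfl⟩ := hpq.symm.dvd_of_dvd_mul_left (by exact_mod_cast hdvd)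
    exact ⟨t, Nat.pos_of_mul_pos_left hs, by simpa using hPs⟩
  · rintro ⟨t, ht, rfl⟩
    have hq' : (0 : ℝ) < q := by positivity
    have ht' : (1 : ℝ) ≤ t := by exact_mod_cast ht
    have hb : (b - a) * q = p * (c - a) := (div_eq_div_iff hδ.ne' hq'.ne').mp hμ
    have hpq' : p < q := by
      have : (p : ℝ) < q := by
        by_contra! h
        nlinarith
      exact_mod_cast this
    have hN : (0 : ℝ) < q * t := by positivity
    have hN1 : (1 : ℝ) < q * t := by
      have : (1 : ℝ) < q := by exact_mod_cast (by omega : 1 < q)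
      nlinarith
    have hinv : 1 / ((q : ℝ) * t) < 1 := (div_lt_one hN).mpr hN1
    have hinv0 : 0 < 1 / ((q : ℝ) * t) := by positivity
    have hmul : (q : ℝ) * t * (1 / ((q : ℝ) * t)) = 1 := mul_one_div_cancel hN.ne'
    generalize 1 / ((q : ℝ) * t) = e at *
    refine mem_IV_of_forall_int_step ⟨by nlinarith, by nlinarith⟩ hN hδ ?_
    rintro y (rfl | rfl | rfl)
    · refine ⟨1 - q * t, ?_, ?_⟩
      · have : 0 ≤ (q : ℤ) * t := by positivity
        linarith
      · push_cast
        linear_combination (c - y) * hmul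
    · refine ⟨t * p - q * t + 1, ?_, ?_⟩
      · have : (t : ℤ) * p ≤ t * q := by gcongr
        linarith
      · push_cast
        linear_combination (c - a) * hmul + (t : ℝ) * hb
    · refine ⟨1, le_rfl, ?_⟩
      push_cast
      linear_combination (y - a) * hmul
end

section
/- Let 0 < μ_1 < μ_2 < ... < μ_r < 1 be real numbers. If μ_i is irrational for some i ∈ {1,...,r}, then IV(0, μ_1, ..., μ_r, 1) = ∅. -/
/-- The sequence starting with `c`, followed by `m` zeros and then by ones. -/
noncomputable def zerosThenOnes (c : ℝ) (m i : ℕ) : ℝ :=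
  if i = 0 then c else if i ≤ m then 0 else 1

theorem avgSeq_zerosThenOnes (c : ℝ) (m t : ℕ) :
    avgSeq (zerosThenOnes c m) (m + 1 + t) = (c + t) / (m + 1 + t) := by
  have h : ∑ i ∈ Finset.range (m + 1 + t), zerosThenOnes c m i = c + t := by
    induction t with
    | zero =>
      rw [add_zero, Finset.sum_range_succ', Finset.sum_eq_zero]
      · simp [zerosThenOnes]
      · intro i hi
        have := Finset.mem_range.mp hi
        simp [zerosThenOnes, show i + 1 ≤ m by omega]
    | succ t ih =>
      rw [← add_assoc, Finset.sum_range_succ, ih]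
      simp [zerosThenOnes, show ¬ m + 1 + t ≤ m by omega]
      ring
  simp [avgSeq, h]

/-- If `c ∈ A` is such that no `c + j` is a positive multiple of `P`, then `P` can be jumped
over. -/
theorem notMem_IV_of_add_ne_mul {A : Set ℝ} (h0 : 0 ∈ A) (h1 : 1 ∈ A) {P c : ℝ} (hc : c ∈ A)
    (h : ∀ j n : ℕ, 0 < n → c + j ≠ n * P) : P ∉ IV A 0 1 := by
  rintro ⟨⟨hP0, hP1⟩, H⟩
  obtain ⟨m, hm⟩ := exists_nat_gt (c / P)
  rw [div_lt_iff₀ hP0] at hm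
  obtain ⟨t, ht⟩ := exists_nat_gt (((m + 1) * P - c) / (1 - P))
  have ht0 : 0 < t := by
    have : (0 : ℝ) < t := lt_trans (div_pos (by linarith) (by linarith)) ht
    exact_mod_cast this
  rw [div_lt_iff₀ (by linarith)] at ht
  obtain ⟨s, hs, -, hsP⟩ := H (zerosThenOnes c m)
    (by intro n; unfold zerosThenOnes; split_ifs <;> assumption)
    (m + 1 + 0) (m + 1 + t) (by omega) (by omega)
    (by
      rw [avgSeq_zerosThenOnes, div_lt_iff₀ (by positivity)]
      push_cast
      linarith)
    (by
      rw [avgSeq_zerosThenOnes, lt_div_iff₀ (by positivity)]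
      linarith)
  obtain ⟨j, rfl⟩ := Nat.exists_eq_add_of_lt hs
  rw [show m + 1 + 0 + j + 1 = m + 1 + (j + 1) by ring, avgSeq_zerosThenOnes,
    div_eq_iff (by positivity)] at hsP
  refine h (j + 1) (m + 1 + (j + 1)) (by omega) ?_
  rw [hsP]
  push_cast
  ring

/-- THEOREM 6: if `0 < μ_1 < ... < μ_r < 1` and some `μ_i` is irrational, then
`IV(0, μ_1, ..., μ_r, 1) = ∅`. Here `μ` is indexed by `1, ..., r`. -/
theorem IV_multi_irrational (r : ℕ) (hr : 1 ≤ r) (μ : ℕ → ℝ)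
    (hmono : ∀ i j, 1 ≤ i → i < j → j ≤ r → μ i < μ j)
    (hbounds : ∀ i, 1 ≤ i → i ≤ r → 0 < μ i ∧ μ i < 1)
    (hirr : ∃ i, 1 ≤ i ∧ i ≤ r ∧ Irrational (μ i)) :
    IV (insert 0 (insert 1 {y : ℝ | ∃ i, 1 ≤ i ∧ i ≤ r ∧ y = μ i})) 0 1 = ∅ := by
  refine Set.eq_empty_of_forall_notMem fun P => ?_
  obtain ⟨i, hi1, hir, hi⟩ := hirr
  by_cases hP : Irrational P
  · refine notMem_IV_of_add_ne_mul (by simp) (by simp) (c := 0) (by simp) fun j n hn hj => ?_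
    refine (hP.natCast_mul hn.ne').ne_nat j ?_
    linarith
  · refine notMem_IV_of_add_ne_mul (by simp) (by simp) (c := μ i)
      (Or.inr (Or.inr ⟨i, hi1, hir, rfl⟩)) fun j n hn hj => ?_
    obtain ⟨q, rfl⟩ := not_not.mp hP
    refine (hi.add_natCast j).ne_rat (n * q) ?_
    rw [hj]
    push_cast
    rfl
end

section
/- Let a_1 < a_2 < ... < a_r be real numbers with r ≥ 3, and for i = 2, ..., r-1 set μ_i = (a_i - a_1)/(a_r - a_1). (a) If μ_i is irrational for some i ∈ {2,...,r-1}, then DV(a_1,...,a_r) = ∅. (b) If every μ_i is rational, say μ_i = p_i/q_i with gcd(p_i, q_i) = 1, and M = lcm(q_2, ..., q_{r-1}), then DV(a_1,...,a_r) = { (1 - 1/(M·t))·a_1 + (1/(M·t))·a_r : t ∈ ℕ, t ≥ 1 }. -/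
/-- `DV A a b` : the set of values `P ∈ (a,b)` such that for every sequence with terms in `A`,
the consecutive averages cannot pass from above `P` to below `P` without hitting `P`
at an intermediate index. -/
def DV (A : Set ℝ) (a b : ℝ) : Set ℝ :=
  {P | P ∈ Set.Ioo a b ∧ ∀ x : ℕ → ℝ, (∀ n, x n ∈ A) →
    ∀ k l : ℕ, 1 ≤ k → k < l → P < avgSeq x k → avgSeq x l < P →
      ∃ s : ℕ, k < s ∧ s < l ∧ avgSeq x s = P}

/-- An integer sequence whose steps are at least `-1` cannot pass from positive to negative
without vanishing in between. -/
lemma exists_eq_zero_of_pos_of_neg {f : ℕ → ℤ} (hf : ∀ n, f n - 1 ≤ f (n + 1)) {k l : ℕ}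
    (hkl : k < l) (hk : 0 < f k) (hl : f l < 0) : ∃ s, k < s ∧ s < l ∧ f s = 0 := by
  induction l with
  | zero => omega
  | succ l ih =>
    have h := hf l
    rcases lt_trichotomy (f l) 0 with h0 | h0 | h0
    · have hne : k ≠ l := by rintro rfl; omega
      obtain ⟨s, h1, h2, h3⟩ := ih (by omega) h0
      exact ⟨s, h1, by omega, h3⟩
    · have hne : k ≠ l := by rintro rfl; omega
      exact ⟨l, by omega, by omega, h0⟩
    · omega

lemma avgSeq_sub_eq_div (x : ℕ → ℝ) (a P : ℝ) {n : ℕ} (hn : 1 ≤ n) :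
    avgSeq x n - P = ((∑ i ∈ Finset.range n, (x i - a)) - n * (P - a)) / n := by
  have hn' : (n : ℝ) ≠ 0 := by positivity
  simp only [avgSeq, Finset.sum_sub_distrib, Finset.sum_const, Finset.card_range, nsmul_eq_mul]
  field_simp
  ring

lemma lt_avgSeq_iff (x : ℕ → ℝ) (a P : ℝ) {n : ℕ} (hn : 1 ≤ n) :
    P < avgSeq x n ↔ n * (P - a) < ∑ i ∈ Finset.range n, (x i - a) := by
  have hn' : (0 : ℝ) < n := by positivity
  rw [← sub_pos, avgSeq_sub_eq_div x a P hn, div_pos_iff_of_pos_right hn', sub_pos]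

lemma avgSeq_lt_iff (x : ℕ → ℝ) (a P : ℝ) {n : ℕ} (hn : 1 ≤ n) :
    avgSeq x n < P ↔ ∑ i ∈ Finset.range n, (x i - a) < n * (P - a) := by
  have hn' : (0 : ℝ) < n := by positivity
  rw [← sub_neg, avgSeq_sub_eq_div x a P hn, div_lt_iff₀ hn', zero_mul, sub_neg]

lemma avgSeq_eq_iff (x : ℕ → ℝ) (a P : ℝ) {n : ℕ} (hn : 1 ≤ n) :
    avgSeq x n = P ↔ ∑ i ∈ Finset.range n, (x i - a) = n * (P - a) := by
  have hn' : (n : ℝ) ≠ 0 := by positivity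
  rw [← sub_eq_zero, avgSeq_sub_eq_div x a P hn, div_eq_zero_iff, or_iff_left hn', sub_eq_zero]

/-- If `P ∈ DV A a b` and `y ∈ A`, then `b + y - 2a` is a multiple of `P - a`, as witnessed by the
sequence `b, y, a, a, a, …`. -/
lemma exists_nat_mul_of_mem_DV {A : Set ℝ} {a b P y : ℝ} (ha : a ∈ A) (hb : b ∈ A)
    (hP : P ∈ DV A a b) (hy : y ∈ A) : ∃ n : ℕ, (b - a) + (y - a) = n * (P - a) := by
  obtain ⟨⟨haP, hPb⟩, h⟩ := hP
  let x : ℕ → ℝ := fun n => if n = 0 then b else if n = 1 then y else a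
  have hsum : ∀ n, ∑ i ∈ Finset.range (n + 2), (x i - a) = (b - a) + (y - a) := by
    intro n
    induction n with
    | zero => simp [x, Finset.sum_range_succ]; ring
    | succ n ih => rw [Finset.sum_range_succ, ih]; simp [x]
  obtain ⟨N, hN⟩ := exists_nat_gt (((b - a) + (y - a)) / (P - a))
  rw [div_lt_iff₀ (sub_pos.2 haP)] at hN
  have hlt : avgSeq x (N + 2) < P := by
    rw [avgSeq_lt_iff x a P (by omega), hsum]
    push_cast
    nlinarith
  obtain ⟨s, hs, -, hsP⟩ := h x (fun n => by dsimp only [x]; split_ifs <;> assumption) 1 (N + 2)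
    le_rfl (by omega) (by simpa [avgSeq, x] using hPb) hlt
  obtain ⟨m, rfl⟩ : ∃ m, s = m + 2 := ⟨s - 2, by omega⟩
  rw [avgSeq_eq_iff x a P (by omega), hsum] at hsP
  exact ⟨m + 2, hsP⟩

/-- `P` lies in `DV A a b` exactly when every element of `A` differs from `a` by a multiple
of `P - a`. -/
lemma mem_DV_iff {A : Set ℝ} {a b P : ℝ} (ha : a ∈ A) (hb : b ∈ A) (hA : ∀ y ∈ A, a ≤ y) :
    P ∈ DV A a b ↔ P ∈ Set.Ioo a b ∧ ∀ y ∈ A, ∃ n : ℕ, y - a = n * (P - a) := by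
  constructor
  · refine fun hP => ⟨hP.1, fun y hy => ?_⟩
    obtain ⟨N, hN⟩ := exists_nat_mul_of_mem_DV ha hb hP ha
    obtain ⟨n, hn⟩ := exists_nat_mul_of_mem_DV ha hb hP hy
    have hpos : 0 < P - a := sub_pos.2 hP.1.1
    have hNn : N ≤ n := by
      have : (N : ℝ) * (P - a) ≤ n * (P - a) := by linarith [hA y hy]
      exact_mod_cast le_of_mul_le_mul_right this hpos
    exact ⟨n - N, by push_cast [hNn]; linarith⟩
  · rintro ⟨hP, h⟩
    refine ⟨hP, fun x hx k l hk hkl hkP hlP => ?_⟩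
    have hpos : 0 < P - a := sub_pos.2 hP.1
    choose m hm using fun n => h (x n) (hx n)
    let f : ℕ → ℤ := fun n => (∑ i ∈ Finset.range n, (m i : ℤ)) - n
    have hf : ∀ n, (∑ i ∈ Finset.range n, (x i - a)) - n * (P - a) = f n * (P - a) := by
      intro n
      simp only [f, hm, ← Finset.sum_mul]
      push_cast
      ring
    rw [lt_avgSeq_iff x a P hk, ← sub_pos, hf, mul_pos_iff_of_pos_right hpos] at hkP
    rw [avgSeq_lt_iff x a P (by omega), ← sub_neg, hf, ← neg_pos, ← neg_mul,
      mul_pos_iff_of_pos_right hpos, neg_pos] at hlP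
    obtain ⟨s, h1, h2, h3⟩ := exists_eq_zero_of_pos_of_neg (f := f)
      (fun n => by simp only [f, Finset.sum_range_succ]; push_cast; omega) hkl
      (by exact_mod_cast hkP) (by exact_mod_cast hlP)
    refine ⟨s, h1, h2, ?_⟩
    rw [avgSeq_eq_iff x a P (by omega), ← sub_eq_zero, hf, h3]
    simp

/-- THEOREM 10: let `a_1 < ... < a_r` (`r ≥ 3`), indexed here by `a 0, ..., a (r-1)`, and for
`1 ≤ i ≤ r - 2` set `μ_i = (a_i - a_0)/(a_{r-1} - a_0)`. (a) If some `μ_i` is irrational then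
`DV(a_1,...,a_r) = ∅`. (b) If each `μ_i = p_i/q_i` in lowest terms and `M = lcm` of the `q_i`,
then `DV(a_1,...,a_r) = { (1 - 1/(M·t))·a_1 + (1/(M·t))·a_r : t ≥ 1 }`. -/
theorem DV_general (r : ℕ) (hr : 3 ≤ r) (a : ℕ → ℝ)
    (hmono : ∀ i j, i < j → j < r → a i < a j) :
    ((∃ i, 1 ≤ i ∧ i ≤ r - 2 ∧ Irrational ((a i - a 0) / (a (r - 1) - a 0))) →
      DV {y : ℝ | ∃ i, i < r ∧ y = a i} (a 0) (a (r - 1)) = ∅) ∧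
    (∀ p q : ℕ → ℕ,
      (∀ i, 1 ≤ i → i ≤ r - 2 →
        0 < p i ∧ 0 < q i ∧ Nat.Coprime (p i) (q i) ∧
          (a i - a 0) / (a (r - 1) - a 0) = (p i : ℝ) / q i) →
      DV {y : ℝ | ∃ i, i < r ∧ y = a i} (a 0) (a (r - 1)) =
        {y : ℝ | ∃ t : ℕ, 1 ≤ t ∧
          y = (1 - 1 / ((((Finset.Icc 1 (r - 2)).lcm q : ℕ) : ℝ) * t)) * a 0 +
              (1 / ((((Finset.Icc 1 (r - 2)).lcm q : ℕ) : ℝ) * t)) * a (r - 1)}) := by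
  have hA : ∀ P, P ∈ DV {y : ℝ | ∃ i, i < r ∧ y = a i} (a 0) (a (r - 1)) ↔
      P ∈ Set.Ioo (a 0) (a (r - 1)) ∧ ∀ i < r, ∃ n : ℕ, a i - a 0 = n * (P - a 0) := by
    intro P
    have hmem : ∀ i < r, a i ∈ {y : ℝ | ∃ i, i < r ∧ y = a i} := fun i hi => ⟨i, hi, rfl⟩
    rw [mem_DV_iff (hmem 0 (by omega)) (hmem (r - 1) (by omega))]
    · simp only [Set.mem_ofPred_eq, forall_exists_index, and_imp]
      exact and_congr_right fun _ => ⟨fun h i hi => h _ i hi rfl, fun h y i hi hy => hy ▸ h i hi⟩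
    · rintro y ⟨i, hi, rfl⟩
      rcases Nat.eq_zero_or_pos i with rfl | h0
      · exact le_rfl
      · exact (hmono 0 i h0 hi).le
  have hab : 0 < a (r - 1) - a 0 := sub_pos.2 (hmono 0 (r - 1) (by omega) (by omega))
  constructor
  · rintro ⟨i, hi1, hi2, hirr⟩
    refine Set.eq_empty_of_forall_notMem fun P hP => hirr ?_
    obtain ⟨⟨haP, -⟩, h⟩ := (hA P).1 hP
    obtain ⟨n, hn⟩ := h i (by omega)
    obtain ⟨N, hN⟩ := h (r - 1) (by omega)
    refine ⟨(n : ℚ) / N, ?_⟩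
    rw [hn, hN, mul_div_mul_right _ _ (sub_pos.2 haP).ne']
    push_cast
    rfl
  · intro p q hpq
    set M := (Finset.Icc 1 (r - 2)).lcm q
    have hdvd : ∀ i, 1 ≤ i → i ≤ r - 2 → q i ∣ M := fun i h1 h2 =>
      Finset.dvd_lcm (Finset.mem_Icc.2 ⟨h1, h2⟩)
    have hM0 : M ≠ 0 := by
      rw [Ne, Finset.lcm_eq_zero_iff]
      rintro ⟨i, hi, h0⟩
      have hi' := Finset.mem_Icc.1 hi
      have := (hpq i hi'.1 hi'.2).2.1
      omega
    have hM2 : 2 ≤ M := by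
      obtain ⟨hp, hq, -, he⟩ := hpq 1 le_rfl (by omega)
      have hlt : (a 1 - a 0) / (a (r - 1) - a 0) < 1 := by
        rw [div_lt_one hab]
        linarith [hmono 1 (r - 1) (by omega) (by omega)]
      rw [he, div_lt_one (by exact_mod_cast hq)] at hlt
      have hlt' : p 1 < q 1 := by exact_mod_cast hlt
      have := Nat.le_of_dvd (by omega) (hdvd 1 le_rfl (by omega))
      omega
    ext P
    rw [hA, Set.mem_ofPred_eq]
    constructor
    · rintro ⟨⟨haP, -⟩, h⟩
      have hd : 0 < P - a 0 := sub_pos.2 haP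
      obtain ⟨N, hN⟩ := h (r - 1) (by omega)
      have hN0 : 0 < N := by
        rw [hN, mul_pos_iff_of_pos_right hd] at hab
        exact_mod_cast hab
      have hMN : M ∣ N := by
        refine Finset.lcm_dvd fun i hi => ?_
        obtain ⟨hi1, hi2⟩ := Finset.mem_Icc.1 hi
        obtain ⟨hp, hq, hc, he⟩ := hpq i hi1 hi2
        obtain ⟨n, hn⟩ := h i (by omega)
        rw [hn, hN, mul_div_mul_right _ _ hd.ne', div_eq_div_iff (by positivity) (by positivity)]
          at he
        have he' : n * q i = p i * N := by exact_mod_cast he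
        exact hc.symm.dvd_of_dvd_mul_left (he' ▸ dvd_mul_left _ _)
      obtain ⟨t, rfl⟩ := hMN
      refine ⟨t, Nat.pos_of_mul_pos_left hN0, ?_⟩
      have hN' : ((M : ℝ) * t) ≠ 0 := by exact_mod_cast hN0.ne'
      push_cast at hN
      rw [eq_add_of_sub_eq hN]
      have h1 : 1 / ((M : ℝ) * t) * (M * t) = 1 := one_div_mul_cancel hN'
      linear_combination (-(P - a 0)) * h1
    · rintro ⟨t, ht, rfl⟩
      have hMt : (1 : ℝ) < M * t := by
        have : 1 < M * t := by nlinarith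
        exact_mod_cast this
      have hMt0 : (M : ℝ) * t ≠ 0 := by positivity
      have hd : (1 - 1 / ((M : ℝ) * t)) * a 0 + 1 / ((M : ℝ) * t) * a (r - 1) - a 0 =
          (a (r - 1) - a 0) / (M * t) := by ring
      refine ⟨⟨?_, ?_⟩, fun i hi => ?_⟩
      · rw [← sub_pos, hd]
        positivity
      · have := div_lt_self hab hMt
        linarith
      · rw [hd]
        rcases Nat.eq_zero_or_pos i with rfl | h0
        · exact ⟨0, by simp⟩
        rcases eq_or_ne i (r - 1) with rfl | h1
        · exact ⟨M * t, by push_cast; field_simp⟩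
        obtain ⟨hp, hq, -, he⟩ := hpq i h0 (by omega)
        obtain ⟨c, hc⟩ := hdvd i h0 (by omega)
        refine ⟨p i * c * t, ?_⟩
        rw [div_eq_iff hab.ne'] at he
        have hqi : (q i : ℝ) ≠ 0 := by positivity
        have hcM : (M : ℝ) = q i * c := by exact_mod_cast hc
        rw [he]
        push_cast
        rw [hcM] at hMt0 ⊢
        have hc0 : (c : ℝ) ≠ 0 := right_ne_zero_of_mul (left_ne_zero_of_mul hMt0)
        field_simp
end
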